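/- Let b₀, …, bₙ : ℝ → Matrix (Fin r) (Fin r) ℝ be smooth, let P : ℝ → Matrix (Fin r) (Fin m) ℝ and Q : ℝ → Matrix (Fin m) (Fin r) ℝ be smooth with support bounded below, and let M : ℝ → Matrix (Fin r) (Fin m') ℝ, N : ℝ → Matrix (Fin m') (Fin r) ℝ be smooth. Set 𝕋 = Σ_{i=0}^{n} M_{b_i}∘D^i + M_P∘I∘M_Q and X = M_M∘I∘M_N on W_r, and define X·P := M·I(N·P), X*·Q := -I(Q·M)·N, 𝕃·M := Σ_{i=0}^{n} b_i·M^{(i)} + P·I(Q·M), and 𝕃*·N := Σ_{i=0}^{n} (-1)^i (N·b_i)^{(i)} - I(N·P)·Q. Then there exist smooth c₀, …, c_{n-1} : ℝ → Matrix (Fin r) (Fin r) ℝ such that, as operators on W_r, X∘𝕋 - 𝕋∘X = M_M∘I∘M_{𝕃*·N} - M_{𝕃·M}∘I∘M_N + M_{X·P}∘I∘M_Q - M_P∘I∘M_{X*·Q} + Σ_{i=0}^{n-1} M_{c_i}∘D^i. (This is the identity [X, 𝕃]₋ = [M∂⁻¹𝕃*(N) - 𝕃(M)∂⁻¹N] +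 [X(P^{(r)})∂⁻¹Q^{(r)} - P^{(r)}∂⁻¹X*(Q^{(r)})] for X = M∂⁻¹N.) -/

import Mathlib

open MeasureTheory Finset

/-- A function `ℝ → A` has support bounded below. -/
def SuppBddBelowR {A : Type*} [Zero A] (f : ℝ → A) : Prop :=
  ∃ a : ℝ, ∀ x : ℝ, x ≤ a → f x = 0

/-- The integration operator applied componentwise to vector-valued functions. -/
noncomputable def IopV {p : ℕ} (f : ℝ → Fin p → ℝ) : ℝ → Fin p → ℝ :=
  fun x => ∫ y in Set.Iic x, f y

/-- The integration operator applied entrywise to matrix-valued functions. -/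
noncomputable def matInt {p q : ℕ} (a : ℝ → Matrix (Fin p) (Fin q) ℝ) :
    ℝ → Matrix (Fin p) (Fin q) ℝ :=
  fun x => Matrix.of fun i j => ∫ y in Set.Iic x, a y i j

/-- The `k`-th derivative applied entrywise to matrix-valued functions. -/
noncomputable def matIter {p q : ℕ} (k : ℕ) (a : ℝ → Matrix (Fin p) (Fin q) ℝ) :
    ℝ → Matrix (Fin p) (Fin q) ℝ :=
  fun x => Matrix.of fun i j => iteratedDeriv k (fun y => a y i j) x

/-- A matrix-valued function is smooth (entrywise `C^∞`). -/
def MatSmooth {p q : ℕ} (a : ℝ → Matrix (Fin p) (Fin q) ℝ) : Prop :=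
  ∀ (i : Fin p) (j : Fin q), ContDiff ℝ (⊤ : ℕ∞) fun x => a x i j

/-- The operator `𝕋 = Σ_{i=0}^{n} M_{b_i}∘Dⁱ + M_P∘I∘M_Q` acting on `W_r`. -/
noncomputable def TTop {r m : ℕ} (n : ℕ) (b : ℕ → ℝ → Matrix (Fin r) (Fin r) ℝ)
    (P : ℝ → Matrix (Fin r) (Fin m) ℝ) (Q : ℝ → Matrix (Fin m) (Fin r) ℝ)
    (g : ℝ → Fin r → ℝ) : ℝ → Fin r → ℝ :=
  fun x => (∑ i ∈ Finset.range (n + 1), (b i x).mulVec (iteratedDeriv i g x))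
    + (P x).mulVec (IopV (fun y => (Q y).mulVec (g y)) x)

/-- The operator `X = M_M∘I∘M_N` acting on `W_r`. -/
noncomputable def Xop {r m' : ℕ} (M : ℝ → Matrix (Fin r) (Fin m') ℝ)
    (N : ℝ → Matrix (Fin m') (Fin r) ℝ) (g : ℝ → Fin r → ℝ) : ℝ → Fin r → ℝ :=
  fun x => (M x).mulVec (IopV (fun y => (N y).mulVec (g y)) x)

/-- The action `𝕃·F = Σ_{i=0}^{n} b_i·F⁽ⁱ⁾ + P·I(Q·F)` on matrix-valued functions. -/
noncomputable def LLMat {r m p : ℕ} (n : ℕ) (b : ℕ → ℝ → Matrix (Fin r) (Fin r) ℝ)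
    (P : ℝ → Matrix (Fin r) (Fin m) ℝ) (Q : ℝ → Matrix (Fin m) (Fin r) ℝ)
    (F : ℝ → Matrix (Fin r) (Fin p) ℝ) : ℝ → Matrix (Fin r) (Fin p) ℝ :=
  fun x => (∑ i ∈ Finset.range (n + 1), b i x * matIter i F x)
    + P x * matInt (fun y => Q y * F y) x

/-- The adjoint action `𝕃*·G = Σ_{i=0}^{n} (-1)ⁱ(G·b_i)⁽ⁱ⁾ - I(G·P)·Q`. -/
noncomputable def LLStarMat {r m p : ℕ} (n : ℕ) (b : ℕ → ℝ → Matrix (Fin r) (Fin r) ℝ)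
    (P : ℝ → Matrix (Fin r) (Fin m) ℝ) (Q : ℝ → Matrix (Fin m) (Fin r) ℝ)
    (G : ℝ → Matrix (Fin p) (Fin r) ℝ) : ℝ → Matrix (Fin p) (Fin r) ℝ :=
  fun x => (∑ i ∈ Finset.range (n + 1),
      ((-1 : ℝ) ^ i) • matIter i (fun y => G y * b i y) x)
    - matInt (fun y => G y * P y) x * Q x

section IntegrationFromNegInfinity

variable {E : Type*} [NormedAddCommGroup E]

lemma Continuous.integrableOn_Iic_of_suppBddBelow {f : ℝ → E} (hf : Continuous f)
    (hs : SuppBddBelowR f) (x : ℝ) : IntegrableOn f (Set.Iic x) := by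
  obtain ⟨a, ha⟩ := hs
  refine IntegrableOn.mono_set (t := Set.Iic a ∪ Set.Icc a x) ?_ fun y hy => ?_
  · refine IntegrableOn.union ?_ hf.continuousOn.integrableOn_Icc
    exact (integrableOn_zero (ε' := E)).congr_fun (fun y hy => (ha y hy).symm) measurableSet_Iic
  · rcases le_total y a with h | h
    exacts [Or.inl h, Or.inr ⟨h, hy⟩]

variable [NormedSpace ℝ E]

lemma suppBddBelow_integral_Iic {f : ℝ → E} (hs : SuppBddBelowR f) :
    SuppBddBelowR fun x => ∫ y in Set.Iic x, f y := by
  obtain ⟨a, ha⟩ := hs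
  exact ⟨a, fun x hx => setIntegral_eq_zero_of_forall_eq_zero
    fun y hy => ha y (le_trans hy hx)⟩

lemma hasDerivAt_integral_Iic [CompleteSpace E] {f : ℝ → E} (hf : Continuous f)
    (hs : SuppBddBelowR f) (x : ℝ) :
    HasDerivAt (fun x => ∫ y in Set.Iic x, f y) (f x) x := by
  have hint := hf.integrableOn_Iic_of_suppBddBelow hs
  have heq : (fun x => ∫ y in Set.Iic x, f y)
      = fun x => (∫ y in Set.Iic (0 : ℝ), f y) + ∫ y in (0 : ℝ)..x, f y := by
    funext x
    rw [← intervalIntegral.integral_Iic_sub_Iic (hint 0) (hint x)]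
    abel
  rw [heq]
  exact (intervalIntegral.integral_hasDerivAt_right (hf.intervalIntegrable _ _)
    (hf.stronglyMeasurableAtFilter _ _) hf.continuousAt).const_add _

lemma integral_Iic_eq_of_hasDerivAt [CompleteSpace E] {f F : ℝ → E} (hf : Continuous f)
    (hs : SuppBddBelowR f) (hF : ∀ x, HasDerivAt F (f x) x) (hFs : SuppBddBelowR F) (x : ℝ) :
    ∫ y in Set.Iic x, f y = F x := by
  have hd : ∀ y, HasDerivAt (fun x => (∫ y in Set.Iic x, f y) - F x) 0 y := fun y => by
    simpa using (hasDerivAt_integral_Iic hf hs y).fun_sub (hF y)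
  obtain ⟨a, ha⟩ := suppBddBelow_integral_Iic hs
  obtain ⟨c, hc⟩ := hFs
  have h := is_const_of_deriv_eq_zero (fun y => (hd y).differentiableAt)
    (fun y => (hd y).deriv) x (min a c)
  simp only [ha _ (min_le_left a c), hc _ (min_le_right a c), sub_zero] at h
  exact sub_eq_zero.mp h

lemma ContDiff.integral_Iic [CompleteSpace E] {f : ℝ → E} (hf : ContDiff ℝ (⊤ : ℕ∞) f)
    (hs : SuppBddBelowR f) : ContDiff ℝ (⊤ : ℕ∞) fun x => ∫ y in Set.Iic x, f y := by
  have hd := hasDerivAt_integral_Iic hf.continuous hs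
  refine contDiff_infty_iff_deriv.mpr ⟨fun x => (hd x).differentiableAt, ?_⟩
  rwa [funext fun x => (hd x).deriv]

protected lemma SuppBddBelowR.iteratedDeriv {f : ℝ → E} (hs : SuppBddBelowR f) (k : ℕ) :
    SuppBddBelowR (iteratedDeriv k f) := by
  obtain ⟨a, ha⟩ := hs
  refine ⟨a - 1, fun x hx => ?_⟩
  have h : f =ᶠ[nhds x] fun _ => (0 : E) := by
    filter_upwards [Iio_mem_nhds (show x < a by linarith)] with y hy using ha y (le_of_lt hy)
  rw [h.iteratedDeriv_eq k]
  simp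

lemma ContDiff.iteratedDeriv_infty {f : ℝ → E} (hf : ContDiff ℝ (⊤ : ℕ∞) f) (k : ℕ) :
    ContDiff ℝ (⊤ : ℕ∞) (iteratedDeriv k f) := by
  rw [iteratedDeriv_eq_iterate]
  exact hf.iterate_deriv k

lemma ContDiff.hasDerivAt_iteratedDeriv {f : ℝ → E} (hf : ContDiff ℝ (⊤ : ℕ∞) f) (k : ℕ)
    (x : ℝ) : HasDerivAt (iteratedDeriv k f) (iteratedDeriv (k + 1) f x) x := by
  rw [iteratedDeriv_succ]
  exact ((contDiff_infty_iff_deriv.mp (hf.iteratedDeriv_infty k)).1 x).hasDerivAt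

end IntegrationFromNegInfinity

section SuppBddBelow

lemma SuppBddBelowR.add {A : Type*} [AddZeroClass A] {f g : ℝ → A} (hf : SuppBddBelowR f)
    (hg : SuppBddBelowR g) : SuppBddBelowR fun x => f x + g x := by
  obtain ⟨s, hs⟩ := hf
  obtain ⟨t, ht⟩ := hg
  refine ⟨min s t, fun x hx => ?_⟩
  simp only [hs x (hx.trans (min_le_left s t)), ht x (hx.trans (min_le_right s t)), add_zero]

lemma SuppBddBelowR.mul_left {p q s : ℕ} {b : ℝ → Matrix (Fin q) (Fin s) ℝ}
    (a : ℝ → Matrix (Fin p) (Fin q) ℝ) (hb : SuppBddBelowR b) :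
    SuppBddBelowR fun x => a x * b x := by
  obtain ⟨t, ht⟩ := hb
  exact ⟨t, fun x hx => by simp [ht x hx]⟩

lemma SuppBddBelowR.mul_right {p q s : ℕ} {a : ℝ → Matrix (Fin p) (Fin q) ℝ}
    (ha : SuppBddBelowR a) (b : ℝ → Matrix (Fin q) (Fin s) ℝ) :
    SuppBddBelowR fun x => a x * b x := by
  obtain ⟨t, ht⟩ := ha
  exact ⟨t, fun x hx => by simp [ht x hx]⟩

lemma SuppBddBelowR.entry {p q : ℕ} {a : ℝ → Matrix (Fin p) (Fin q) ℝ}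
    (ha : SuppBddBelowR a) (i : Fin p) (j : Fin q) : SuppBddBelowR fun x => a x i j := by
  obtain ⟨t, ht⟩ := ha
  exact ⟨t, fun x hx => by simp [ht x hx]⟩

lemma SuppBddBelowR.mulVec {p q : ℕ} (a : ℝ → Matrix (Fin p) (Fin q) ℝ)
    {g : ℝ → Fin q → ℝ} (hg : SuppBddBelowR g) : SuppBddBelowR fun x => (a x).mulVec (g x) := by
  obtain ⟨t, ht⟩ := hg
  exact ⟨t, fun x hx => by simp [ht x hx]⟩

end SuppBddBelow

section MatSmooth

variable {p q s : ℕ}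

lemma matSmooth_zero : MatSmooth (fun _ => (0 : Matrix (Fin p) (Fin q) ℝ)) :=
  fun _ _ => contDiff_const

lemma MatSmooth.add {a b : ℝ → Matrix (Fin p) (Fin q) ℝ} (ha : MatSmooth a)
    (hb : MatSmooth b) : MatSmooth fun x => a x + b x :=
  fun i j => (ha i j).add (hb i j)

lemma MatSmooth.sub {a b : ℝ → Matrix (Fin p) (Fin q) ℝ} (ha : MatSmooth a)
    (hb : MatSmooth b) : MatSmooth fun x => a x - b x :=
  fun i j => (ha i j).sub (hb i j)

lemma MatSmooth.mul {a : ℝ → Matrix (Fin p) (Fin q) ℝ} {b : ℝ → Matrix (Fin q) (Fin s) ℝ}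
    (ha : MatSmooth a) (hb : MatSmooth b) : MatSmooth fun x => a x * b x := fun i j => by
  simp only [Matrix.mul_apply]
  exact ContDiff.sum fun k _ => (ha i k).mul (hb k j)

protected lemma MatSmooth.matIter {a : ℝ → Matrix (Fin p) (Fin q) ℝ} (ha : MatSmooth a) (k : ℕ) :
    MatSmooth (matIter k a) :=
  fun i j => (ha i j).iteratedDeriv_infty k

protected lemma MatSmooth.matInt {a : ℝ → Matrix (Fin p) (Fin q) ℝ} (ha : MatSmooth a)
    (hs : SuppBddBelowR a) : MatSmooth (matInt a) :=
  fun i j => (ha i j).integral_Iic (hs.entry i j)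

lemma MatSmooth.contDiff_mulVec {a : ℝ → Matrix (Fin p) (Fin q) ℝ} (ha : MatSmooth a)
    {g : ℝ → Fin q → ℝ} (hg : ContDiff ℝ (⊤ : ℕ∞) g) :
    ContDiff ℝ (⊤ : ℕ∞) fun x => (a x).mulVec (g x) := by
  refine contDiff_pi.mpr fun i => ?_
  simp only [Matrix.mulVec, dotProduct]
  exact ContDiff.sum fun k _ => (ha i k).mul (contDiff_pi.mp hg k)

lemma matIter_zero (a : ℝ → Matrix (Fin p) (Fin q) ℝ) : matIter 0 a = a := by
  funext x
  ext i j
  simp [matIter]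

lemma matIter_matIter_one (k : ℕ) (a : ℝ → Matrix (Fin p) (Fin q) ℝ) :
    matIter k (matIter 1 a) = matIter (k + 1) a := by
  funext x
  ext i j
  simp [matIter, iteratedDeriv_succ']

lemma hasDerivAt_mulVec {a : ℝ → Matrix (Fin p) (Fin q) ℝ} {a' : Matrix (Fin p) (Fin q) ℝ}
    {g : ℝ → Fin q → ℝ} {g' : Fin q → ℝ} {x : ℝ}
    (ha : ∀ i j, HasDerivAt (fun y => a y i j) (a' i j) x) (hg : HasDerivAt g g' x) :
    HasDerivAt (fun y => (a y).mulVec (g y)) (a'.mulVec (g x) + (a x).mulVec g') x := by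
  refine hasDerivAt_pi.mpr fun i => ?_
  simp only [Matrix.mulVec, dotProduct, Pi.add_apply, ← Finset.sum_add_distrib]
  exact HasDerivAt.fun_sum fun k _ => (ha i k).mul (hasDerivAt_pi.mp hg k)

lemma MatSmooth.hasDerivAt_matIter_mulVec {a : ℝ → Matrix (Fin p) (Fin q) ℝ}
    (ha : MatSmooth a) (k : ℕ) {g : ℝ → Fin q → ℝ} {g' : Fin q → ℝ} {x : ℝ}
    (hg : HasDerivAt g g' x) :
    HasDerivAt (fun y => (matIter k a y).mulVec (g y))
      ((matIter (k + 1) a x).mulVec (g x) + (matIter k a x).mulVec g') x :=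
  hasDerivAt_mulVec (fun i j => (ha i j).hasDerivAt_iteratedDeriv k x) hg

lemma MatSmooth.hasDerivAt_mulVec {a : ℝ → Matrix (Fin p) (Fin q) ℝ}
    (ha : MatSmooth a) {g : ℝ → Fin q → ℝ} {g' : Fin q → ℝ} {x : ℝ} (hg : HasDerivAt g g' x) :
    HasDerivAt (fun y => (a y).mulVec (g y))
      ((matIter 1 a x).mulVec (g x) + (a x).mulVec g') x := by
  simpa only [matIter_zero] using ha.hasDerivAt_matIter_mulVec 0 hg

end MatSmooth

/-- The space `W_p` of smooth vector-valued functions with support bounded below. -/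
def IsSmoothSuppBddBelow {p : ℕ} (g : ℝ → Fin p → ℝ) : Prop :=
  ContDiff ℝ (⊤ : ℕ∞) g ∧ SuppBddBelowR g

section IopV

variable {p q : ℕ}

lemma IsSmoothSuppBddBelow.mulVec {g : ℝ → Fin q → ℝ} (hg : IsSmoothSuppBddBelow g)
    {a : ℝ → Matrix (Fin p) (Fin q) ℝ} (ha : MatSmooth a) :
    IsSmoothSuppBddBelow fun x => (a x).mulVec (g x) :=
  ⟨ha.contDiff_mulVec hg.1, hg.2.mulVec a⟩

protected lemma IsSmoothSuppBddBelow.iteratedDeriv {g : ℝ → Fin q → ℝ} (hg : IsSmoothSuppBddBelow g)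
    (k : ℕ) : IsSmoothSuppBddBelow (iteratedDeriv k g) :=
  ⟨hg.1.iteratedDeriv_infty k, hg.2.iteratedDeriv k⟩

lemma IsSmoothSuppBddBelow.iopV {g : ℝ → Fin q → ℝ} (hg : IsSmoothSuppBddBelow g) :
    IsSmoothSuppBddBelow (IopV g) :=
  ⟨hg.1.integral_Iic hg.2, suppBddBelow_integral_Iic hg.2⟩

lemma IsSmoothSuppBddBelow.hasDerivAt_iopV {g : ℝ → Fin q → ℝ} (hg : IsSmoothSuppBddBelow g)
    (x : ℝ) : HasDerivAt (IopV g) (g x) x :=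
  hasDerivAt_integral_Iic hg.1.continuous hg.2 x

lemma IsSmoothSuppBddBelow.integrableOn_Iic {g : ℝ → Fin q → ℝ} (hg : IsSmoothSuppBddBelow g)
    (x : ℝ) : IntegrableOn g (Set.Iic x) :=
  hg.1.continuous.integrableOn_Iic_of_suppBddBelow hg.2 x

lemma IsSmoothSuppBddBelow.sum {n : ℕ} {f : ℕ → ℝ → Fin q → ℝ}
    (hf : ∀ i, IsSmoothSuppBddBelow (f i)) :
    IsSmoothSuppBddBelow fun x => ∑ i ∈ range n, f i x := by
  refine ⟨ContDiff.sum fun i _ => (hf i).1, ?_⟩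
  induction n with
  | zero => exact ⟨0, fun x _ => by simp⟩
  | succ n ih =>
    simpa only [Finset.sum_range_succ] using ih.add (hf n).2

lemma IopV_add {f g : ℝ → Fin q → ℝ} (hf : IsSmoothSuppBddBelow f)
    (hg : IsSmoothSuppBddBelow g) (x : ℝ) :
    IopV (fun y => f y + g y) x = IopV f x + IopV g x :=
  integral_add (hf.integrableOn_Iic x) (hg.integrableOn_Iic x)

lemma IopV_sub {f g : ℝ → Fin q → ℝ} (hf : IsSmoothSuppBddBelow f)
    (hg : IsSmoothSuppBddBelow g) (x : ℝ) :
    IopV (fun y => f y - g y) x = IopV f x - IopV g x :=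
  integral_sub (hf.integrableOn_Iic x) (hg.integrableOn_Iic x)

lemma IopV_neg (f : ℝ → Fin q → ℝ) (x : ℝ) : IopV (fun y => -f y) x = -IopV f x :=
  integral_neg _

lemma IopV_sum {n : ℕ} {f : ℕ → ℝ → Fin q → ℝ} (hf : ∀ i, IsSmoothSuppBddBelow (f i)) (x : ℝ) :
    IopV (fun y => ∑ i ∈ range n, f i y) x = ∑ i ∈ range n, IopV (f i) x :=
  integral_finsetSum _ fun i _ => (hf i).integrableOn_Iic x

/-- Integration by parts for the integration operator. -/
lemma IopV_mulVec_deriv {a : ℝ → Matrix (Fin p) (Fin q) ℝ} (ha : MatSmooth a)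
    {g g' : ℝ → Fin q → ℝ} (hg : IsSmoothSuppBddBelow g) (hg' : IsSmoothSuppBddBelow g')
    (hd : ∀ x, HasDerivAt g (g' x) x) (x : ℝ) :
    IopV (fun y => (a y).mulVec (g' y)) x
      = (a x).mulVec (g x) - IopV (fun y => (matIter 1 a y).mulVec (g y)) x := by
  have h1 := hg.mulVec (ha.matIter 1)
  have h2 := hg'.mulVec ha
  rw [eq_sub_iff_add_eq', ← IopV_add h1 h2]
  exact integral_Iic_eq_of_hasDerivAt (h1.1.add h2.1).continuous (h1.2.add h2.2)
    (fun y => ha.hasDerivAt_mulVec (hd y)) (hg.mulVec ha).2 x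

lemma matIter_one_matInt {a : ℝ → Matrix (Fin p) (Fin q) ℝ} (ha : MatSmooth a)
    (hs : SuppBddBelowR a) : matIter 1 (matInt a) = a := by
  funext x
  ext i j
  simp only [matIter, Matrix.of_apply, iteratedDeriv_one]
  exact (hasDerivAt_integral_Iic (ha i j).continuous (hs.entry i j) x).deriv

lemma IopV_mulVec_IopV {a : ℝ → Matrix (Fin p) (Fin q) ℝ} (ha : MatSmooth a)
    (hs : SuppBddBelowR a) {g : ℝ → Fin q → ℝ} (hg : IsSmoothSuppBddBelow g) (x : ℝ) :
    IopV (fun y => (a y).mulVec (IopV g y)) x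
      = (matInt a x).mulVec (IopV g x) - IopV (fun y => (matInt a y).mulVec (g y)) x := by
  have h := IopV_mulVec_deriv (ha.matInt hs) hg.iopV hg hg.hasDerivAt_iopV x
  rw [matIter_one_matInt ha hs] at h
  rw [h, sub_sub_cancel]

end IopV

/-- `L` is a local differential operator of order less than `n` with smooth coefficients. -/
def IsLocalDiffOp {p r : ℕ} (n : ℕ) (L : (ℝ → Fin r → ℝ) → ℝ → Fin p → ℝ) : Prop :=
  ∃ c : ℕ → ℝ → Matrix (Fin p) (Fin r) ℝ, (∀ i, MatSmooth (c i)) ∧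
    ∀ g : ℝ → Fin r → ℝ, ContDiff ℝ (⊤ : ℕ∞) g → ∀ x,
      L g x = ∑ i ∈ range n, (c i x).mulVec (iteratedDeriv i g x)

namespace IsLocalDiffOp

variable {p q r n : ℕ} {L K : (ℝ → Fin r → ℝ) → ℝ → Fin p → ℝ}

lemma mono (hL : IsLocalDiffOp n L) {k : ℕ} (h : n ≤ k) : IsLocalDiffOp k L := by
  obtain ⟨c, hc, hcL⟩ := hL
  refine ⟨fun i => if i < n then c i else fun _ => 0, fun i => ?_, fun g hg x => ?_⟩
  · dsimp only
    split_ifs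
    exacts [hc i, matSmooth_zero]
  · rw [hcL g hg x]
    refine Finset.sum_subset_zero_on_sdiff (range_subset_range.mpr h) (fun i hi => ?_)
      fun i hi => ?_
    · simp [mem_range.not.mp (Finset.mem_sdiff.mp hi).2]
    · simp [mem_range.mp hi]

lemma zero : IsLocalDiffOp n (fun (_ : ℝ → Fin r → ℝ) _ => (0 : Fin p → ℝ)) :=
  ⟨fun _ _ => 0, fun _ => matSmooth_zero, fun _ _ _ => by simp⟩

lemma add (hL : IsLocalDiffOp n L) (hK : IsLocalDiffOp n K) :
    IsLocalDiffOp n fun g x => L g x + K g x := by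
  obtain ⟨c, hc, hcL⟩ := hL
  obtain ⟨d, hd, hdK⟩ := hK
  refine ⟨fun i x => c i x + d i x, fun i => (hc i).add (hd i), fun g hg x => ?_⟩
  simp only [hcL g hg x, hdK g hg x, Matrix.add_mulVec, Finset.sum_add_distrib]

lemma sub (hL : IsLocalDiffOp n L) (hK : IsLocalDiffOp n K) :
    IsLocalDiffOp n fun g x => L g x - K g x := by
  obtain ⟨c, hc, hcL⟩ := hL
  obtain ⟨d, hd, hdK⟩ := hK
  refine ⟨fun i x => c i x - d i x, fun i => (hc i).sub (hd i), fun g hg x => ?_⟩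
  simp only [hcL g hg x, hdK g hg x, Matrix.sub_mulVec, Finset.sum_sub_distrib]

lemma sum {k : ℕ} {L : ℕ → (ℝ → Fin r → ℝ) → ℝ → Fin p → ℝ}
    (hL : ∀ i < k, IsLocalDiffOp n (L i)) :
    IsLocalDiffOp n fun g x => ∑ i ∈ range k, L i g x := by
  induction k with
  | zero => simpa using zero
  | succ k ih =>
    simp only [Finset.sum_range_succ]
    exact (ih fun i hi => hL i (by omega)).add (hL k (by omega))

lemma mulVec (hL : IsLocalDiffOp n L) {a : ℝ → Matrix (Fin q) (Fin p) ℝ} (ha : MatSmooth a) :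
    IsLocalDiffOp n fun g x => (a x).mulVec (L g x) := by
  obtain ⟨c, hc, hcL⟩ := hL
  refine ⟨fun i x => a x * c i x, fun i => ha.mul (hc i), fun g hg x => ?_⟩
  simp only [hcL g hg x, Matrix.mulVec_sum, Matrix.mulVec_mulVec]

lemma mulVec_iteratedDeriv {a : ℝ → Matrix (Fin p) (Fin r) ℝ} (ha : MatSmooth a) (k : ℕ) :
    IsLocalDiffOp (k + 1) fun g x => (a x).mulVec (iteratedDeriv k g x) := by
  refine ⟨fun i => if i = k then a else fun _ => 0, fun i => ?_, fun g hg x => ?_⟩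
  · dsimp only
    split_ifs
    exacts [ha, matSmooth_zero]
  · rw [Finset.sum_eq_single_of_mem k (self_mem_range_succ k) fun i _ hi => by simp [hi]]
    simp

lemma hasDerivAt (hL : IsLocalDiffOp n L) :
    ∃ K : (ℝ → Fin r → ℝ) → ℝ → Fin p → ℝ, IsLocalDiffOp (n + 1) K ∧
      ∀ g, ContDiff ℝ (⊤ : ℕ∞) g → ∀ x, HasDerivAt (L g) (K g x) x := by
  obtain ⟨c, hc, hcL⟩ := hL
  refine ⟨fun g x => ∑ i ∈ range n, ((matIter 1 (c i) x).mulVec (iteratedDeriv i g x)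
    + (c i x).mulVec (iteratedDeriv (i + 1) g x)), ?_, fun g hg x => ?_⟩
  · exact sum fun i hi => ((mulVec_iteratedDeriv ((hc i).matIter 1) i).mono (by omega)).add
      ((mulVec_iteratedDeriv (hc i) (i + 1)).mono (by omega))
  · rw [funext (hcL g hg)]
    exact HasDerivAt.fun_sum fun i _ =>
      (hc i).hasDerivAt_mulVec (hg.hasDerivAt_iteratedDeriv i x)

end IsLocalDiffOp

/-- Moving all derivatives onto the coefficient: `I ∘ M_a ∘ Dⁱ = (-1)ⁱ I ∘ M_{a⁽ⁱ⁾}` up to a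
local differential operator. -/
lemma exists_IopV_mulVec_iteratedDeriv {p r : ℕ} (i : ℕ) {a : ℝ → Matrix (Fin p) (Fin r) ℝ}
    (ha : MatSmooth a) :
    ∃ L : (ℝ → Fin r → ℝ) → ℝ → Fin p → ℝ, IsLocalDiffOp i L ∧
      ∀ g, IsSmoothSuppBddBelow g → ∀ x,
        IopV (fun y => (a y).mulVec (iteratedDeriv i g y)) x
          = IopV (fun y => ((-1 : ℝ) ^ i • matIter i a y).mulVec (g y)) x + L g x := by
  induction i generalizing a with
  | zero => exact ⟨_, IsLocalDiffOp.zero, fun g hg x => by simp [matIter_zero]⟩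
  | succ i ih =>
    obtain ⟨L, hL, h⟩ := ih (ha.matIter 1)
    refine ⟨fun g x => (a x).mulVec (iteratedDeriv i g x) - L g x,
      (IsLocalDiffOp.mulVec_iteratedDeriv ha i).sub (hL.mono i.le_succ), fun g hg x => ?_⟩
    rw [IopV_mulVec_deriv ha (hg.iteratedDeriv i) (hg.iteratedDeriv (i + 1))
      (hg.1.hasDerivAt_iteratedDeriv i), h g hg x, matIter_matIter_one]
    simp only [pow_succ, mul_neg, mul_one, neg_smul, Matrix.neg_mulVec, IopV_neg]
    abel

/-- The derivatives of `X g = M I(N g)` are `M⁽ⁱ⁾ I(N g)` up to a local differential operator. -/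
lemma exists_iteratedDeriv_Xop {r s : ℕ} {M : ℝ → Matrix (Fin r) (Fin s) ℝ}
    {N : ℝ → Matrix (Fin s) (Fin r) ℝ} (hM : MatSmooth M) (hN : MatSmooth N) (i : ℕ) :
    ∃ L : (ℝ → Fin r → ℝ) → ℝ → Fin r → ℝ, IsLocalDiffOp i L ∧
      ∀ g, IsSmoothSuppBddBelow g → ∀ x,
        iteratedDeriv i (Xop M N g) x
          = (matIter i M x).mulVec (IopV (fun y => (N y).mulVec (g y)) x) + L g x := by
  induction i with
  | zero => exact ⟨_, IsLocalDiffOp.zero, fun g hg x => by simp [matIter_zero, Xop]⟩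
  | succ i ih =>
    obtain ⟨L, hL, h⟩ := ih
    obtain ⟨K, hK, hLK⟩ := hL.hasDerivAt
    refine ⟨fun g x => (matIter i M x * N x).mulVec (iteratedDeriv 0 g x) + K g x,
      ((IsLocalDiffOp.mulVec_iteratedDeriv ((hM.matIter i).mul hN) 0).mono (by omega)).add hK,
      fun g hg x => ?_⟩
    have hd := (hM.hasDerivAt_matIter_mulVec i ((hg.mulVec hN).hasDerivAt_iopV x)).fun_add
      (hLK g hg.1 x)
    rw [iteratedDeriv_succ, funext (h g hg)]
    simpa [Matrix.mulVec_mulVec, add_assoc] using hd.deriv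

/-- with `X = M_M∘I∘M_N`, `X·P = M·I(N·P)` and `X*·Q = -I(Q·M)·N`,
there exist smooth `c₀,…,c_{n-1}` such that, as operators on `W_r`,
`X∘𝕋 - 𝕋∘X = M_M∘I∘M_{𝕃*·N} - M_{𝕃·M}∘I∘M_N + M_{X·P}∘I∘M_Q - M_P∘I∘M_{X*·Q}
  + Σ_{i=0}^{n-1} M_{c_i}∘Dⁱ`. -/
theorem stmt17 {r m m' n : ℕ} (b : ℕ → ℝ → Matrix (Fin r) (Fin r) ℝ)
    (P : ℝ → Matrix (Fin r) (Fin m) ℝ) (Q : ℝ → Matrix (Fin m) (Fin r) ℝ)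
    (M : ℝ → Matrix (Fin r) (Fin m') ℝ) (N : ℝ → Matrix (Fin m') (Fin r) ℝ)
    (hb : ∀ i, MatSmooth (b i)) (hP : MatSmooth P) (hQ : MatSmooth Q)
    (hPsupp : SuppBddBelowR P) (hQsupp : SuppBddBelowR Q)
    (hM : MatSmooth M) (hN : MatSmooth N) :
    ∃ c : ℕ → ℝ → Matrix (Fin r) (Fin r) ℝ,
      (∀ i, MatSmooth (c i)) ∧
      ∀ g : ℝ → Fin r → ℝ, ContDiff ℝ (⊤ : ℕ∞) g → SuppBddBelowR g → ∀ x : ℝ,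
        Xop M N (TTop n b P Q g) x - TTop n b P Q (Xop M N g) x
          = (M x).mulVec (IopV (fun y => (LLStarMat n b P Q N y).mulVec (g y)) x)
            - (LLMat n b P Q M x).mulVec (IopV (fun y => (N y).mulVec (g y)) x)
            + ((fun y => M y * matInt (fun z => N z * P z) y) x).mulVec
                (IopV (fun y => (Q y).mulVec (g y)) x)
            - (P x).mulVec
                (IopV (fun y =>
                  ((fun z => -(matInt (fun w => Q w * M w) z * N z)) y).mulVec (g y)) x)
            + ∑ i ∈ Finset.range n, (c i x).mulVec (iteratedDeriv i g x) := by
  choose A hA hA' using fun i => exists_IopV_mulVec_iteratedDeriv i (hN.mul (hb i))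
  choose B hB hB' using fun i => exists_iteratedDeriv_Xop hM hN i
  have hNP := hN.mul hP
  have hNPs := hPsupp.mul_left N
  have hQM := hQ.mul hM
  have hQMs := hQsupp.mul_right M
  have hlocal : IsLocalDiffOp n fun g x =>
      (∑ i ∈ range (n + 1), (M x).mulVec (A i g x))
        - ∑ i ∈ range (n + 1), (b i x).mulVec (B i g x) :=
    (IsLocalDiffOp.sum fun i hi => ((hA i).mulVec hM).mono (by omega)).sub
      (IsLocalDiffOp.sum fun i hi => ((hB i).mulVec (hb i)).mono (by omega))
  obtain ⟨c, hc, hcL⟩ := hlocal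
  refine ⟨c, hc, fun g hg hgs x => ?_⟩
  have hW : IsSmoothSuppBddBelow g := ⟨hg, hgs⟩
  have hQg := hW.mulVec hQ
  have hNg := hW.mulVec hN
  have hstar : ∀ i, IsSmoothSuppBddBelow fun y =>
      ((-1 : ℝ) ^ i • matIter i (fun y => N y * b i y) y).mulVec (g y) := fun i =>
    hW.mulVec fun j k => ((hN.mul (hb i)).matIter i j k).const_smul ((-1 : ℝ) ^ i)
  have hXT : IopV (fun y => (N y).mulVec (TTop n b P Q g y)) x
      = IopV (fun y => (LLStarMat n b P Q N y).mulVec (g y)) x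
        + (matInt (fun z => N z * P z) x).mulVec (IopV (fun y => (Q y).mulVec (g y)) x)
        + ∑ i ∈ range (n + 1), A i g x := by
    simp only [TTop, LLStarMat, Matrix.mulVec_add, Matrix.mulVec_sum, Matrix.mulVec_mulVec,
      Matrix.sub_mulVec, Matrix.sum_mulVec]
    rw [IopV_add (.sum fun i => (hW.iteratedDeriv i).mulVec (hN.mul (hb i)))
        (hQg.iopV.mulVec hNP),
      IopV_sub (.sum hstar) (hW.mulVec ((hNP.matInt hNPs).mul hQ)),
      IopV_sum fun i => (hW.iteratedDeriv i).mulVec (hN.mul (hb i)), IopV_sum hstar,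
      IopV_mulVec_IopV hNP hNPs hQg,
      Finset.sum_congr rfl fun i _ => hA' i g hW x, Finset.sum_add_distrib]
    simp only [Matrix.mulVec_mulVec]
    abel
  have hTX : TTop n b P Q (Xop M N g) x
      = (LLMat n b P Q M x).mulVec (IopV (fun y => (N y).mulVec (g y)) x)
        - (P x).mulVec (IopV (fun y => (matInt (fun w => Q w * M w) y * N y).mulVec (g y)) x)
        + ∑ i ∈ range (n + 1), (b i x).mulVec (B i g x) := by
    have h := IopV_mulVec_IopV hQM hQMs hNg x
    simp only [Matrix.mulVec_mulVec] at h
    simp only [TTop, LLMat, hB' _ g hW x, Matrix.add_mulVec, Matrix.sum_mulVec,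
      Matrix.mulVec_add, Matrix.mulVec_mulVec, Finset.sum_add_distrib]
    simp only [Xop, Matrix.mulVec_mulVec, h, Matrix.mulVec_sub]
    abel
  rw [hTX, ← hcL g hg x]
  simp only [Xop, hXT, Matrix.mulVec_add, Matrix.mulVec_sum, Matrix.mulVec_mulVec,
    Matrix.neg_mulVec, IopV_neg, Matrix.mulVec_neg]
  abel
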